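/- There exists an absolute constant c > 0 and, for each s ≥ 1, a threshold N(s) such that the following holds for n ≥ N(s). Except with probability at most n^{−s}, a uniformly random subset Ω of {1,…,n} of fixed cardinality |Ω| ≤ n/3 has the following property: for every set T ⊆ {1,…,n} with |T| ≤ c n / (s log⁵ n), it holds that ‖F_{ΩT}‖² ≤ 0.5. -/

import Mathlib

/-- The spectral norm (ℓ2 → ℓ2 operator norm) of a complex matrix. -/
noncomputable def specNorm {α β : Type*} [Fintype α] [Fintype β] [DecidableEq β]
    (A : Matrix α β ℂ) : ℝ :=
  ‖LinearMap.toContinuousLinearMap (Matrix.toEuclideanLin A)‖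

/-- The `n × n` discrete Fourier transform matrix, with entries
`F (j, t) = n^{-1/2} e^{2πi j t / n}` for `j, t = 1, …, n` (indices coded by `Fin n` via
`j ↦ j.val + 1`). -/
noncomputable def dftMatrix (n : ℕ) : Matrix (Fin n) (Fin n) ℂ := fun j t =>
  (1 / (Real.sqrt n : ℂ)) *
    Complex.exp (2 * Real.pi * Complex.I * (((j : ℕ) : ℂ) + 1) * (((t : ℕ) : ℂ) + 1) / (n : ℂ))

/-- The submatrix `F_{ΩT}` of the DFT matrix with rows indexed by `Ω` and columns by `T`. -/
noncomputable def dftSub (n : ℕ) (Ω T : Finset (Fin n)) : Matrix Ω T ℂ :=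
  (dftMatrix n).submatrix (fun ω => (ω : Fin n)) (fun t => (t : Fin n))

attribute [local instance] Classical.propDecidable

/-- The probability that a uniformly random subset `Ω ⊆ {1,…,n}` of fixed cardinality `m`
satisfies the predicate `p`: the number of subsets of cardinality `m` satisfying `p`, divided
by the total number of subsets of cardinality `m`. -/
noncomputable def uniformSetProb (n m : ℕ) (p : Finset (Fin n) → Prop) : ℝ :=
  (((Finset.powersetCard m (Finset.univ : Finset (Fin n))).filter p).card : ℝ) /
    ((Finset.powersetCard m (Finset.univ : Finset (Fin n))).card : ℝ)

/-- The probability that a pair of independent uniformly random subsets `T, Ω ⊆ {1,…,n}` of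
fixed cardinalities `mT` and `mΩ` satisfies the predicate `p`. -/
noncomputable def uniformPairProb (n mT mΩ : ℕ)
    (p : Finset (Fin n) → Finset (Fin n) → Prop) : ℝ :=
  ((((Finset.powersetCard mT (Finset.univ : Finset (Fin n))) ×ˢ
      (Finset.powersetCard mΩ (Finset.univ : Finset (Fin n)))).filter
        fun q => p q.1 q.2).card : ℝ) /
    (((Finset.powersetCard mT (Finset.univ : Finset (Fin n))).card *
      (Finset.powersetCard mΩ (Finset.univ : Finset (Fin n))).card : ℕ) : ℝ)

section Lemmas

open Finset

theorem three_pow_mul_choose_le (b : ℕ) : ∀ n m : ℕ, 3 * m ≤ n → b ≤ m →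
    3 ^ b * (n - b).choose (m - b) ≤ n.choose m := by
  induction b with
  | zero => simp
  | succ b ih =>
    intro n m h hb
    obtain ⟨m, rfl⟩ : ∃ k, m = k + 1 := ⟨m - 1, by omega⟩
    obtain ⟨n, rfl⟩ : ∃ k, n = k + 1 := ⟨n - 1, by omega⟩
    have h1 := ih n m (by omega) (by omega)
    have h2 := Nat.add_one_mul_choose_eq n m
    have h3 : 3 * n.choose m ≤ (n + 1).choose (m + 1) := by
      have : (m + 1) * (3 * n.choose m) ≤ (m + 1) * (n + 1).choose (m + 1) := by nlinarith
      exact Nat.le_of_mul_le_mul_left this (by omega)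
    simp only [Nat.add_sub_add_right]
    rw [pow_succ]
    nlinarith

theorem three_pow_mul_card_filter_subset_le {n m : ℕ} (h : 3 * m ≤ n) (B : Finset (Fin n)) :
    3 ^ #B * #{Ω ∈ powersetCard m (univ : Finset (Fin n)) | B ⊆ Ω} ≤ n.choose m := by
  by_cases hB : #B ≤ m
  · refine le_trans (Nat.mul_le_mul_left _ ?_) (three_pow_mul_choose_le #B n m h hB)
    have : #(powersetCard (m - #B) Bᶜ) = (n - #B).choose (m - #B) := by
      simp [card_compl]
    rw [← this]
    refine card_le_card_of_injOn (· \ B) ?_ ?_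
    · intro Ω hΩ
      simp only [coe_filter, mem_powersetCard, Set.mem_ofPred_eq] at hΩ
      simp only [mem_coe, mem_powersetCard]
      refine ⟨fun a ha => by simp at ha ⊢; exact ha.2, ?_⟩
      rw [card_sdiff_of_subset hΩ.2, hΩ.1.2]
    · intro Ω hΩ Ω' hΩ' he
      simp only [coe_filter, Set.mem_ofPred_eq] at hΩ hΩ'
      simp only at he
      rw [← sdiff_union_of_subset hΩ.2, he, sdiff_union_of_subset hΩ'.2]
  · have : #{Ω ∈ powersetCard m (univ : Finset (Fin n)) | B ⊆ Ω} = 0 := by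
      rw [card_eq_zero, filter_eq_empty_iff]
      intro Ω hΩ hs
      have := card_le_card hs
      rw [(mem_powersetCard.1 hΩ).2] at this
      exact hB this
    simp [this]

/-- Exponential moment of the size of the intersection of a fixed set with a uniformly random set
of cardinality `m ≤ n / 3`. -/
theorem sum_one_add_pow_card_inter_le {n m : ℕ} (h : 3 * m ≤ n) (A : Finset (Fin n)) {a : ℝ}
    (ha : 0 ≤ a) :
    ∑ Ω ∈ powersetCard m (univ : Finset (Fin n)), (1 + a) ^ #(Ω ∩ A) ≤
      n.choose m * (1 + a / 3) ^ #A := by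
  have key (Ω : Finset (Fin n)) : (1 + a) ^ #(Ω ∩ A) =
      ∑ B ∈ A.powerset, if B ⊆ Ω then a ^ #B else 0 := by
    rw [add_comm, ← sum_pow_mul_eq_add_pow, ← sum_filter]
    refine sum_congr ?_ (by simp)
    ext B
    rw [mem_powerset, mem_filter, mem_powerset, subset_inter_iff, and_comm]
  simp_rw [key]
  rw [sum_comm, add_comm (1 : ℝ), ← sum_pow_mul_eq_add_pow, mul_sum]
  refine sum_le_sum fun B _ => ?_
  rw [← sum_filter, sum_const, nsmul_eq_mul, one_pow, mul_one, div_pow]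
  have h1 : (3 : ℝ) ^ #B * #{Ω ∈ powersetCard m (univ : Finset (Fin n)) | B ⊆ Ω} ≤
      n.choose m := by exact_mod_cast three_pow_mul_card_filter_subset_le h B
  have h3 : (0 : ℝ) < 3 ^ #B := by positivity
  rw [← mul_div_assoc, le_div_iff₀ h3]
  nlinarith [mul_le_mul_of_nonneg_left h1 (pow_nonneg ha #B)]

theorem uniformSetProb_mono {n m : ℕ} {p q : Finset (Fin n) → Prop}
    (h : ∀ Ω, #Ω = m → p Ω → q Ω) : uniformSetProb n m p ≤ uniformSetProb n m q := by
  unfold uniformSetProb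
  gcongr 3
  intro Ω hΩ
  rw [mem_filter] at hΩ ⊢
  exact ⟨hΩ.1, h Ω (mem_powersetCard.1 hΩ.1).2 hΩ.2⟩

theorem uniformSetProb_exists_le {n m : ℕ} {ι : Type*} (S : Finset ι)
    (q : ι → Finset (Fin n) → Prop) :
    uniformSetProb n m (fun Ω => ∃ i ∈ S, q i Ω) ≤ ∑ i ∈ S, uniformSetProb n m (q i) := by
  unfold uniformSetProb
  rw [← sum_div]
  gcongr
  norm_cast
  refine le_trans (card_le_card ?_) card_biUnion_le
  intro Ω hΩ
  simp only [mem_filter, mem_biUnion] at hΩ ⊢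
  obtain ⟨h, i, hi, hq⟩ := hΩ
  exact ⟨i, hi, h, hq⟩

/-- Chernoff bound for the intersection of a fixed set with a random set. -/
theorem uniformSetProb_lt_card_inter_le {n m : ℕ} (h : 3 * m ≤ n) (A : Finset (Fin n)) (t : ℝ) :
    uniformSetProb n m (fun Ω => 2 / 5 * (#A : ℝ) + t < #(Ω ∩ A)) ≤ Real.exp (-(t / 6)) := by
  have hc : (0 : ℝ) < n.choose m := by exact_mod_cast Nat.choose_pos (by omega)
  unfold uniformSetProb
  rw [card_powersetCard, card_univ, Fintype.card_fin, div_le_iff₀ hc]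
  set a : ℝ := Real.exp (1 / 6) - 1 with ha
  have ha0 : 0 ≤ a := by
    have := Real.add_one_le_exp (1 / 6 : ℝ)
    rw [ha]; linarith
  have ha1 : a ≤ 1 / 5 := by
    have h1 := Real.add_one_le_exp (-(1 / 6) : ℝ)
    rw [Real.exp_neg] at h1
    have h2 : Real.exp (1 / 6 : ℝ) * (Real.exp (1 / 6 : ℝ))⁻¹ = 1 :=
      mul_inv_cancel₀ (Real.exp_pos _).ne'
    nlinarith [Real.exp_pos (1 / 6 : ℝ)]
  have hmom := sum_one_add_pow_card_inter_le h A ha0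
  have hpow : (1 + a / 3) ^ #A ≤ Real.exp (#A / 15) := by
    calc (1 + a / 3) ^ #A ≤ (Real.exp (1 / 15)) ^ #A := by
          gcongr
          have := Real.add_one_le_exp (1 / 15 : ℝ)
          linarith
      _ = _ := by rw [← Real.exp_nat_mul]; congr 1; ring
  have hlow : (#{Ω ∈ powersetCard m (univ : Finset (Fin n)) |
      2 / 5 * (#A : ℝ) + t < #(Ω ∩ A)} : ℝ) * Real.exp ((2 / 5 * (#A : ℝ) + t) / 6) ≤
      ∑ Ω ∈ powersetCard m (univ : Finset (Fin n)), (1 + a) ^ #(Ω ∩ A) := by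
    rw [← nsmul_eq_mul]
    refine le_trans (card_nsmul_le_sum _ (fun Ω => (1 + a) ^ #(Ω ∩ A)) _ ?_)
      (sum_le_sum_of_subset_of_nonneg (filter_subset _ _) fun _ _ _ => by positivity)
    intro Ω hΩ
    have h1 := (mem_filter.1 hΩ).2
    rw [ha, add_sub_cancel, ← Real.exp_nat_mul]
    exact Real.exp_le_exp.2 (by linarith)
  have h3 : Real.exp ((2 / 5 * (#A : ℝ) + t) / 6) = Real.exp (#A / 15) * Real.exp (t / 6) := by
    rw [← Real.exp_add]; congr 1; ring
  rw [h3] at hlow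
  have h4 := hlow.trans (hmom.trans (mul_le_mul_of_nonneg_left hpow hc.le))
  rw [Real.exp_neg, inv_mul_eq_div, le_div_iff₀ (Real.exp_pos _)]
  have := Real.exp_pos ((#A : ℝ) / 15)
  refine le_of_mul_le_mul_right ?_ this
  linarith

theorem sum_mul_exp_le {α : Type*} [Fintype α] {w X : α → ℝ} (hw : ∀ a, 0 ≤ w a)
    (hw1 : ∑ a, w a = 1) {M : ℝ} (hM : 0 < M) (hX : ∀ a, |X a| ≤ M)
    (h0 : ∑ a, w a * X a = 0) (r : ℝ) :
    ∑ a, w a * Real.exp (r * X a) ≤ Real.exp ((r * M) ^ 2 / 2) := by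
  refine le_trans ?_ (Real.cosh_le_exp_half_sq (r * M))
  have key (a : α) : Real.exp (r * X a) ≤ Real.cosh (r * M) + X a * (Real.sinh (r * M) / M) := by
    have ⟨h1, h2⟩ := abs_le.1 (hX a)
    have hl : -1 ≤ X a / M := by rw [le_div_iff₀ hM]; linarith
    have hr : X a / M ≤ 1 := by rw [div_le_iff₀ hM]; linarith
    have := convexOn_exp.2 (Set.mem_univ (r * M)) (Set.mem_univ (-(r * M)))
      (by linarith : 0 ≤ (1 + X a / M) / 2) (by linarith : 0 ≤ (1 - X a / M) / 2) (by ring)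
    rw [smul_eq_mul, smul_eq_mul, smul_eq_mul, smul_eq_mul] at this
    rw [Real.cosh_eq, Real.sinh_eq]
    have e : (1 + X a / M) / 2 * (r * M) + (1 - X a / M) / 2 * -(r * M) = r * X a := by
      field_simp
      ring
    rw [e] at this
    refine this.trans_eq ?_
    ring
  calc _ ≤ ∑ a, w a * (Real.cosh (r * M) + X a * (Real.sinh (r * M) / M)) :=
        sum_le_sum fun a _ => mul_le_mul_of_nonneg_left (key a) (hw a)
    _ = (∑ a, w a) * Real.cosh (r * M) + (∑ a, w a * X a) * (Real.sinh (r * M) / M) := by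
        rw [sum_mul, sum_mul, ← sum_add_distrib]
        exact sum_congr rfl fun a _ => by ring
    _ = _ := by rw [hw1, h0]; ring

/-- Hoeffding's inequality with a union bound, as an existence statement: some tuple of samples
makes all the sums of the mean-zero functions `X g` small. -/
theorem exists_tuple_sum_lt {α G : Type*} [Fintype α] [Fintype G] {w : α → ℝ} {X : G → α → ℝ}
    (hw : ∀ a, 0 ≤ w a) (hw1 : ∑ a, w a = 1) {M : ℝ} (hM : 0 < M) (hX : ∀ g a, |X g a| ≤ M)
    (h0 : ∀ g, ∑ a, w a * X g a = 0) {L : ℕ} (hL : 0 < L) {u : ℝ} (hu : 0 ≤ u)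
    (h : Fintype.card G * Real.exp (-(u ^ 2 / (2 * L * M ^ 2))) < 1) :
    ∃ p : Fin L → α, ∀ g, ∑ l, X g (p l) < u := by
  by_contra! hcon
  have hL' : (0 : ℝ) < L := by exact_mod_cast hL
  set r : ℝ := u / (L * M ^ 2) with hr
  have hr0 : 0 ≤ r := by positivity
  have hone : ∑ p : Fin L → α, ∏ l, w (p l) = 1 := by
    rw [← Fintype.sum_pow, hw1, one_pow]
  have hle : ∑ p : Fin L → α, ∏ l, w (p l) ≤
      ∑ p : Fin L → α, ∑ g, Real.exp (-(r * u)) * ∏ l, (w (p l) * Real.exp (r * X g (p l))) := by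
    refine sum_le_sum fun p _ => ?_
    obtain ⟨g, hg⟩ := hcon p
    have hnn : 0 ≤ ∏ l, w (p l) := prod_nonneg fun l _ => hw _
    refine le_trans ?_ (single_le_sum
      (f := fun g => Real.exp (-(r * u)) * ∏ l, (w (p l) * Real.exp (r * X g (p l))))
      (fun g _ => mul_nonneg (Real.exp_pos _).le
        (prod_nonneg fun l _ => mul_nonneg (hw _) (Real.exp_pos _).le)) (mem_univ g))
    rw [prod_mul_distrib, ← Real.exp_sum, ← mul_sum, mul_left_comm, ← Real.exp_add]
    refine le_mul_of_one_le_right hnn (Real.one_le_exp ?_)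
    nlinarith [mul_le_mul_of_nonneg_left hg hr0]
  rw [hone, sum_comm] at hle
  have hg (g : G) : ∑ p : Fin L → α, Real.exp (-(r * u)) *
      ∏ l, (w (p l) * Real.exp (r * X g (p l))) ≤ Real.exp (-(u ^ 2 / (2 * L * M ^ 2))) := by
    rw [← mul_sum, ← Fintype.sum_pow (fun a => w a * Real.exp (r * X g a))]
    calc _ ≤ Real.exp (-(r * u)) * Real.exp ((r * M) ^ 2 / 2) ^ L := by
          gcongr
          · exact sum_nonneg fun a _ => mul_nonneg (hw _) (Real.exp_pos _).le
          · exact sum_mul_exp_le hw hw1 hM (hX g) (h0 g) r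
      _ = _ := by
          rw [← Real.exp_nat_mul, ← Real.exp_add]
          congr 1
          rw [hr]
          field_simp
          ring
  have := hle.trans (sum_le_sum fun g _ => hg g)
  rw [sum_const, card_univ, nsmul_eq_mul] at this
  linarith

/-- The four complex units, used to decompose complex numbers with nonnegative coefficients. -/
noncomputable def quarterPhase : Fin 4 → ℂ := ![1, Complex.I, -1, -Complex.I]

/-- The nonnegative coefficients of a complex number with respect to `quarterPhase`. -/
noncomputable def quarterCoeff (z : ℂ) : Fin 4 → ℝ :=
  ![max z.re 0, max z.im 0, max (-z.re) 0, max (-z.im) 0]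

theorem quarterCoeff_nonneg (z : ℂ) (q : Fin 4) : 0 ≤ quarterCoeff z q := by
  fin_cases q <;> simp [quarterCoeff]

theorem max_zero_add_max_neg_zero (a : ℝ) : max a 0 + max (-a) 0 = |a| := by
  rcases le_total 0 a with h | h
  · rw [max_eq_left h, max_eq_right (by linarith), abs_of_nonneg h, add_zero]
  · rw [max_eq_right h, max_eq_left (by linarith), abs_of_nonpos h, zero_add]

theorem max_zero_sub_max_neg_zero (a : ℝ) : max a 0 - max (-a) 0 = a := by
  rcases le_total 0 a with h | h
  · rw [max_eq_left h, max_eq_right (by linarith), sub_zero]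
  · rw [max_eq_right h, max_eq_left (by linarith)]; ring

theorem sum_quarterCoeff (z : ℂ) : ∑ q, quarterCoeff z q = |z.re| + |z.im| := by
  rw [← max_zero_add_max_neg_zero, ← max_zero_add_max_neg_zero]
  simp only [Fin.sum_univ_four, quarterCoeff, Matrix.cons_val]
  ring

theorem sum_quarterCoeff_mul (z : ℂ) : ∑ q, (quarterCoeff z q : ℂ) * quarterPhase q = z := by
  have h1 := max_zero_sub_max_neg_zero z.re
  have h2 := max_zero_sub_max_neg_zero z.im
  apply Complex.ext
  · simp [Fin.sum_univ_four, quarterCoeff, quarterPhase]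
    linarith
  · simp [Fin.sum_univ_four, quarterCoeff, quarterPhase]
    linarith

theorem sum_quarterPhase : ∑ q, quarterPhase q = 0 := by
  simp [Fin.sum_univ_four, quarterPhase]

theorem norm_quarterPhase (q : Fin 4) : ‖quarterPhase q‖ = 1 := by
  fin_cases q <;> simp [quarterPhase]

theorem norm_le_two_mul_of_re_quarterPhase_mul_le {z : ℂ} {c : ℝ}
    (h : ∀ d, (quarterPhase d * z).re ≤ c) : ‖z‖ ≤ 2 * c := by
  have h0 := h 0
  have h1 := h 1
  have h2 := h 2
  have h3 := h 3
  simp [quarterPhase] at h0 h1 h2 h3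
  have hr : |z.re| ≤ c := abs_le.2 ⟨by linarith, by linarith⟩
  have hi : |z.im| ≤ c := abs_le.2 ⟨by linarith, by linarith⟩
  linarith [Complex.norm_le_abs_re_add_abs_im z]

/-- The value at row `j` of the empirical mean of `L` signed columns of `U`, scaled by `R`. -/
noncomputable def columnMean {n L : ℕ} (U : Matrix (Fin n) (Fin n) ℂ) (R : ℝ)
    (p : Fin L → Fin n × Fin 4) (j : Fin n) : ℂ :=
  R / L * ∑ l, quarterPhase (p l).2 * U j (p l).1

/-- Maurey's empirical method in the sup norm. -/
theorem exists_columnMean_approx {n : ℕ} (hn : 0 < n) {U : Matrix (Fin n) (Fin n) ℂ}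
    (hU : ∀ j t, ‖U j t‖ ≤ 1) {x : Fin n → ℂ} {R : ℝ} (hR : 0 < R)
    (hx : ∑ t, (|(x t).re| + |(x t).im|) ≤ R)
    {L : ℕ} (hL : 0 < L) {τ : ℝ} (hτ : 0 ≤ τ)
    (h : 4 * n * Real.exp (-(L * τ ^ 2 / (32 * R ^ 2))) < 1) :
    ∃ p : Fin L → Fin n × Fin 4, ∀ j, ‖columnMean U R p j - U.mulVec x j‖ ≤ τ := by
  have hn' : (0 : ℝ) < n := by exact_mod_cast hn
  have hL' : (0 : ℝ) < L := by exact_mod_cast hL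
  set S : ℝ := ∑ t, (|(x t).re| + |(x t).im|) with hS
  set w : Fin n × Fin 4 → ℝ := fun a =>
    quarterCoeff (x a.1) a.2 / R + (1 - S / R) / (4 * n) with hw
  have hw0 (a) : 0 ≤ w a := by
    have := quarterCoeff_nonneg (x a.1) a.2
    have : 0 ≤ 1 - S / R := by rw [sub_nonneg, div_le_one hR]; exact hx
    positivity
  have hw1 : ∑ a, w a = 1 := by
    rw [Fintype.sum_prod_type]
    simp only [hw, sum_add_distrib, ← sum_div, sum_quarterCoeff, ← hS]
    simp
    field_simp
    ring
  have hwU (j : Fin n) : ∑ a, (w a : ℂ) * (R * (quarterPhase a.2 * U j a.1)) = U.mulVec x j := by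
    rw [Fintype.sum_prod_type, Matrix.mulVec, dotProduct]
    refine sum_congr rfl fun t _ => ?_
    have hR' : (R : ℂ) ≠ 0 := by exact_mod_cast hR.ne'
    calc _ = (∑ q, (quarterCoeff (x t) q : ℂ) * quarterPhase q) * U j t +
          (((1 - S / R) / (4 * n) : ℝ) : ℂ) * R * U j t * ∑ q, quarterPhase q := by
          rw [sum_mul, mul_sum, ← sum_add_distrib]
          refine sum_congr rfl fun q _ => ?_
          simp only [hw]
          rw [Complex.ofReal_add, Complex.ofReal_div]
          field_simp
      _ = _ := by rw [sum_quarterCoeff_mul, sum_quarterPhase]; ring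
  have hnorm (j : Fin n) (a : Fin n × Fin 4) : ‖R * (quarterPhase a.2 * U j a.1)‖ ≤ R := by
    rw [norm_mul, norm_mul, norm_quarterPhase, Complex.norm_real, Real.norm_of_nonneg hR.le,
      one_mul]
    exact mul_le_of_le_one_right hR.le (hU _ _)
  have hy (j : Fin n) : ‖U.mulVec x j‖ ≤ R := by
    rw [← hwU j]
    calc _ ≤ ∑ a, w a * R := by
          refine norm_sum_le_of_le _ fun a _ => ?_
          rw [norm_mul, Complex.norm_real, Real.norm_of_nonneg (hw0 a)]
          exact mul_le_mul_of_nonneg_left (hnorm j a) (hw0 a)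
      _ = R := by rw [← sum_mul, hw1, one_mul]
  obtain ⟨p, hp⟩ := exists_tuple_sum_lt (G := Fin n × Fin 4) (w := w)
    (X := fun g a => (quarterPhase g.2 * (R * (quarterPhase a.2 * U g.1 a.1) - U.mulVec x g.1)).re)
    hw0 hw1 (M := 2 * R) (by positivity)
    (by
      intro g a
      refine (Complex.abs_re_le_norm _).trans ?_
      rw [norm_mul, norm_quarterPhase, one_mul]
      refine (norm_sub_le _ _).trans ?_
      linarith [hnorm g.1 a, hy g.1])
    (by
      intro g
      have : ∑ a, (w a : ℂ) * (quarterPhase g.2 *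
          (R * (quarterPhase a.2 * U g.1 a.1) - U.mulVec x g.1)) = 0 := by
        calc _ = quarterPhase g.2 * (∑ a, (w a : ℂ) * (R * (quarterPhase a.2 * U g.1 a.1)) -
              ((∑ a, w a : ℝ) : ℂ) * U.mulVec x g.1) := by
              rw [Complex.ofReal_sum, sum_mul, ← sum_sub_distrib, mul_sum]
              exact sum_congr rfl fun a _ => by ring
          _ = 0 := by rw [hwU, hw1]; simp
      have h2 := congrArg Complex.re this
      rw [Complex.re_sum, Complex.zero_re] at h2
      rw [← h2]
      exact sum_congr rfl fun a _ => by rw [Complex.re_ofReal_mul])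
    hL (u := L * τ / 2) (by positivity)
    (by
      refine lt_of_eq_of_lt ?_ h
      rw [Fintype.card_prod, Fintype.card_fin, Fintype.card_fin]
      push_cast
      rw [mul_comm (n : ℝ) 4]
      congr 3
      field_simp
      ring)
  refine ⟨p, fun j => ?_⟩
  have hsum : (L : ℂ) * (columnMean U R p j - U.mulVec x j) =
      ∑ l, (R * (quarterPhase (p l).2 * U j (p l).1) - U.mulVec x j) := by
    have hL'' : (L : ℂ) ≠ 0 := by exact_mod_cast hL.ne'
    rw [sum_sub_distrib, ← mul_sum, columnMean, sum_const, card_univ, Fintype.card_fin,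
      nsmul_eq_mul]
    field_simp
  have hle : ‖(L : ℂ) * (columnMean U R p j - U.mulVec x j)‖ ≤ 2 * (L * τ / 2) := by
    refine norm_le_two_mul_of_re_quarterPhase_mul_le fun d => ?_
    rw [hsum, mul_sum, Complex.re_sum]
    exact (hp (j, d)).le
  rw [norm_mul, Complex.norm_natCast] at hle
  refine le_of_mul_le_mul_left ?_ hL'
  linarith

theorem sub_le_mul_card_filter {v h : ℝ} (hv : 0 ≤ v) (hh : 0 < h) {K : ℕ} (hK : v ≤ h * K) :
    v - h ≤ h * #((Icc 1 K).filter fun i : ℕ => h * (i : ℝ) ≤ v) := by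
  have hfl : ⌊v / h⌋₊ ≤ K := by
    rw [← Nat.floor_natCast (R := ℝ) K]
    apply Nat.floor_le_floor
    rw [div_le_iff₀ hh]; linarith
  have hsub : Icc 1 ⌊v / h⌋₊ ⊆ ((Icc 1 K).filter fun i : ℕ => h * (i : ℝ) ≤ v) := by
    intro i hi
    rw [mem_Icc] at hi
    rw [mem_filter, mem_Icc]
    refine ⟨⟨hi.1, hi.2.trans hfl⟩, ?_⟩
    have := (Nat.le_floor_iff (by positivity)).1 hi.2
    rw [le_div_iff₀ hh] at this
    linarith
  have hc := card_le_card hsub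
  rw [Nat.card_Icc, Nat.add_sub_cancel] at hc
  have hc' : (⌊v / h⌋₊ : ℝ) ≤ #((Icc 1 K).filter fun i : ℕ => h * (i : ℝ) ≤ v) := by
    exact_mod_cast hc
  have := Nat.lt_floor_add_one (v / h)
  rw [div_lt_iff₀ hh] at this
  nlinarith

theorem mul_card_filter_mul_le {v h : ℝ} (hv : 0 ≤ v) (hh : 0 < h) (K : ℕ) :
    h * #((Icc 1 K).filter fun i : ℕ => h * (i : ℝ) ≤ v) ≤ v := by
  have hsub : ((Icc 1 K).filter fun i : ℕ => h * (i : ℝ) ≤ v) ⊆ Icc 1 ⌊v / h⌋₊ := by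
    intro i hi
    rw [mem_filter, mem_Icc] at hi
    rw [mem_Icc]
    refine ⟨hi.1.1, Nat.le_floor ?_⟩
    rw [le_div_iff₀ hh]
    linarith [hi.2]
  have hc := card_le_card hsub
  rw [Nat.card_Icc, Nat.add_sub_cancel] at hc
  have hc' : (#((Icc 1 K).filter fun i : ℕ => h * (i : ℝ) ≤ v) : ℝ) ≤ ⌊v / h⌋₊ := by
    exact_mod_cast hc
  have := Nat.floor_le (div_nonneg hv hh.le)
  rw [le_div_iff₀ hh] at this
  nlinarith

/-- Layer-cake comparison of a sum over a subset with the full sum. -/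
theorem sum_le_of_card_superlevel_le {ι : Type*} [Fintype ι] {v : ι → ℝ} (hv : ∀ j, 0 ≤ v j)
    (Ω : Finset ι) {h β γ : ℝ} (hh : 0 < h) (hβ : 0 < β) (hγ : 0 ≤ γ) {K : ℕ}
    (hK : ∀ j, v j ≤ h * K) (e : ℕ → ℝ)
    (hcard : ∀ i ∈ Icc 1 K, (#{j ∈ Ω | h * (i : ℝ) ≤ v j} : ℝ) ≤
      γ * #{j | β * (h * (i : ℝ)) ≤ v j} + e i) :
    ∑ j ∈ Ω, v j ≤ h * #Ω + γ / β * ∑ j, v j + h * ∑ i ∈ Icc 1 K, e i := by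
  have hswap (s : Finset ι) (P : ℕ → ι → Prop) :
      ∑ j ∈ s, (#{i ∈ Icc 1 K | P i j} : ℝ) = ∑ i ∈ Icc 1 K, (#{j ∈ s | P i j} : ℝ) := by
    exact_mod_cast sum_card_bipartiteAbove_eq_sum_card_bipartiteBelow (fun j i => P i j)
  have h1 : ∑ j ∈ Ω, (v j - h) ≤ h * ∑ i ∈ Icc 1 K, (#{j ∈ Ω | h * (i : ℝ) ≤ v j} : ℝ) := by
    rw [← hswap, mul_sum]
    exact sum_le_sum fun j _ => sub_le_mul_card_filter (hv j) hh (hK j)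
  have h2 : β * h * ∑ i ∈ Icc 1 K, (#{j | β * (h * (i : ℝ)) ≤ v j} : ℝ) ≤ ∑ j, v j := by
    rw [← hswap, mul_sum]
    refine sum_le_sum fun j _ => ?_
    simp_rw [← mul_assoc]
    exact mul_card_filter_mul_le (hv j) (by positivity) K
  have h3 := sum_le_sum hcard
  rw [sum_add_distrib, ← mul_sum] at h3
  rw [sum_sub_distrib, sum_const, nsmul_eq_mul] at h1
  have h4 : γ * h * ∑ i ∈ Icc 1 K, (#{j | β * (h * (i : ℝ)) ≤ v j} : ℝ) ≤ γ / β * ∑ j, v j := by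
    rw [div_mul_eq_mul_div, le_div_iff₀ hβ]
    nlinarith [mul_le_mul_of_nonneg_left h2 hγ]
  nlinarith [mul_le_mul_of_nonneg_left h3 hh.le]

theorem conjTranspose_dftMatrix_mul_self {n : ℕ} :
    (dftMatrix n).conjTranspose * dftMatrix n = 1 := by
  ext t t'
  have hn : n ≠ 0 := by have := t.2; omega
  have hn' : (n : ℂ) ≠ 0 := by exact_mod_cast hn
  set z : ℂ := 2 * Real.pi * Complex.I * (((t' : ℕ) : ℂ) - ((t : ℕ) : ℂ)) / n with hz
  have hterm (j : Fin n) : star (dftMatrix n j t) * dftMatrix n j t' =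
      1 / n * (Complex.exp z * Complex.exp z ^ (j : ℕ)) := by
    have hs : (1 / (Real.sqrt n : ℂ)) * (1 / (Real.sqrt n : ℂ)) = 1 / n := by
      rw [div_mul_div_comm, one_mul, ← Complex.ofReal_mul, Real.mul_self_sqrt (by positivity)]
      simp
    rw [← pow_succ', ← Complex.exp_nat_mul, ← hs]
    simp only [dftMatrix, Complex.star_def, map_mul, map_div₀, map_one, Complex.conj_ofReal,
      ← Complex.exp_conj]
    rw [mul_mul_mul_comm, ← Complex.exp_add]
    congr 2
    simp only [map_add, map_one, map_natCast, map_ofNat, Complex.conj_I, hz]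
    push_cast
    field_simp
    ring
  rw [Matrix.mul_apply]
  simp only [Matrix.conjTranspose_apply, hterm]
  rw [← mul_sum, ← mul_sum, Fin.sum_univ_eq_sum_range (fun j => Complex.exp z ^ j)]
  by_cases h : t = t'
  · subst h
    have : z = 0 := by simp [hz]
    simp [this, hn']
  · rw [Matrix.one_apply_ne h]
    have hne : Complex.exp z ≠ 1 := by
      rw [Ne, Complex.exp_eq_one_iff]
      rintro ⟨k, hk⟩
      have h2 : (2 * Real.pi * Complex.I : ℂ) ≠ 0 := Complex.two_pi_I_ne_zero
      have h3 : (((t' : ℕ) : ℂ) - ((t : ℕ) : ℂ)) = k * n := by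
        rw [hz] at hk
        field_simp at hk
        refine mul_left_cancel₀ h2 ?_
        linear_combination (2 * Real.pi * Complex.I) * hk
      have h4 : ((t' : ℕ) : ℤ) - ((t : ℕ) : ℤ) = k * n := by exact_mod_cast h3
      have h5 : k = 0 := by
        by_contra hk0
        have h6 : (n : ℤ) ≤ |((t' : ℕ) : ℤ) - ((t : ℕ) : ℤ)| := by
          rw [h4, abs_mul, Nat.abs_cast]
          exact le_mul_of_one_le_left (by positivity) (Int.one_le_abs hk0)
        have := t.2
        have := t'.2
        rcases abs_cases (((t' : ℕ) : ℤ) - ((t : ℕ) : ℤ)) with h | h <;> omega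
      rw [h5] at h4
      exact h (Fin.ext (by omega))
    have hpow : Complex.exp z ^ n = 1 := by
      rw [← Complex.exp_nat_mul, Complex.exp_eq_one_iff]
      refine ⟨((t' : ℕ) : ℤ) - ((t : ℕ) : ℤ), ?_⟩
      rw [hz]
      push_cast
      field_simp
    rw [geom_sum_eq hne, hpow]
    simp

theorem sum_norm_sq_dftMatrix_mulVec {n : ℕ} (x : Fin n → ℂ) :
    ∑ j, ‖(dftMatrix n).mulVec x j‖ ^ 2 = ∑ t, ‖x t‖ ^ 2 := by
  have key (y : Fin n → ℂ) : ((∑ j, ‖y j‖ ^ 2 : ℝ) : ℂ) = star y ⬝ᵥ y := by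
    simp [dotProduct, Complex.conj_mul']
  rw [← Complex.ofReal_inj, key, key, Matrix.star_mulVec, Matrix.dotProduct_mulVec,
    Matrix.vecMul_vecMul, conjTranspose_dftMatrix_mul_self, Matrix.vecMul_one]

theorem norm_dftMatrix_apply {n : ℕ} (j t : Fin n) : ‖dftMatrix n j t‖ = 1 / Real.sqrt n := by
  have : (2 * Real.pi * Complex.I * (((j : ℕ) : ℂ) + 1) * (((t : ℕ) : ℂ) + 1) / (n : ℂ)) =
      ((2 * Real.pi * ((j : ℕ) + 1) * ((t : ℕ) + 1) / n : ℝ) : ℂ) * Complex.I := by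
    push_cast
    ring
  rw [dftMatrix, this, norm_mul, Complex.norm_exp_ofReal_mul_I]
  simp

/-- A bound on `specNorm` of a submatrix of the DFT matrix from a bound on sparse vectors. -/
theorem specNorm_dftSub_sq_le {n : ℕ} {Ω T : Finset (Fin n)} {C : ℝ} (hC : 0 ≤ C)
    (h : ∀ x : Fin n → ℂ, (∀ t ∉ T, x t = 0) → ∑ t, ‖x t‖ ^ 2 = 1 →
      ∑ j ∈ Ω, ‖(dftMatrix n).mulVec x j‖ ^ 2 ≤ C) :
    specNorm (dftSub n Ω T) ^ 2 ≤ C := by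
  suffices specNorm (dftSub n Ω T) ≤ Real.sqrt C by
    calc _ ≤ Real.sqrt C ^ 2 := by
          gcongr
          exact norm_nonneg _
      _ = C := Real.sq_sqrt hC
  unfold specNorm
  refine ContinuousLinearMap.opNorm_le_of_unit_norm (Real.sqrt_nonneg _) fun v hv => ?_
  rw [LinearMap.coe_toContinuousLinearMap', EuclideanSpace.norm_eq]
  apply Real.sqrt_le_sqrt
  set x : Fin n → ℂ := fun t => if ht : t ∈ T then v ⟨t, ht⟩ else 0 with hx
  have hsum {β : Type} [AddCommMonoid β] (f : Fin n → ℂ → β) (hf : ∀ t, f t 0 = 0) :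
      ∑ t, f t (x t) = ∑ t : T, f t (v t) := by
    rw [← sum_subset (subset_univ T), ← sum_coe_sort]
    · exact sum_congr rfl fun t _ => by simp [hx]
    · intro t _ ht
      simp [hx, ht, hf]
  have hx1 : ∑ t, ‖x t‖ ^ 2 = 1 := by
    rw [hsum (fun _ z => ‖z‖ ^ 2) (by simp), ← EuclideanSpace.norm_sq_eq, hv, one_pow]
  refine le_trans (le_of_eq ?_) (h x (fun t ht => by simp [hx, ht]) hx1)
  rw [← sum_coe_sort Ω]
  refine sum_congr rfl fun j _ => ?_
  congr 2
  rw [Matrix.mulVec, dotProduct, hsum (fun t z => dftMatrix n j t * z) (by simp)]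
  rfl

/-- The rows where the scaled mean of the sampled columns of the normalized DFT matrix is at least
`39 / 40` of the `i`-th level `√(i / 20)`. -/
noncomputable def levelSet {n L : ℕ} (κ : ℝ) (i : ℕ) (p : Fin L → Fin n × Fin 4) :
    Finset (Fin n) :=
  {j | 39 / 40 * Real.sqrt (1 / 20 * i) ≤
    ‖columnMean ((Real.sqrt n : ℂ) • dftMatrix n) (Real.sqrt (2 * κ)) p j‖}

theorem sum_abs_re_add_abs_im_le {ι : Type*} [Fintype ι] {T : Finset ι} {κ : ℝ}
    (hT : (#T : ℝ) ≤ κ) {x : ι → ℂ} (hx : ∀ t ∉ T, x t = 0) (hx1 : ∑ t, ‖x t‖ ^ 2 = 1) :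
    ∑ t, (|(x t).re| + |(x t).im|) ≤ Real.sqrt (2 * κ) := by
  apply Real.le_sqrt_of_sq_le
  rw [← sum_subset (subset_univ T) (fun t _ ht => by simp [hx t ht])]
  calc _ ≤ #T * ∑ t ∈ T, (|(x t).re| + |(x t).im|) ^ 2 := sq_sum_le_card_mul_sum_sq
    _ ≤ #T * ∑ t ∈ T, 2 * ‖x t‖ ^ 2 := by
        gcongr with t
        rw [Complex.sq_norm, Complex.normSq_apply, ← abs_mul_abs_self (x t).re,
          ← abs_mul_abs_self (x t).im]
        nlinarith [sq_nonneg (|(x t).re| - |(x t).im|)]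
    _ ≤ #T * (2 * 1) := by
        rw [← mul_sum, ← hx1]
        gcongr
        exact subset_univ T
    _ ≤ 2 * κ := by linarith

/-- If `Ω` meets every level set in about the expected proportion, then sparse vectors have little
Fourier energy on `Ω`. -/
theorem sum_norm_sq_dftMatrix_mulVec_le {n : ℕ} (hn : 0 < n) {Ω T : Finset (Fin n)} {κ : ℝ}
    (hκ : 0 < κ) (hT : (#T : ℝ) ≤ κ) {K : ℕ} (hK : 40 * κ ≤ K) {L : ℕ → ℕ} (hL : ∀ i, 0 < L i)
    (hexp : ∀ i ∈ Icc 1 K, 4 * n * Real.exp (-(L i * i / (2048000 * κ))) < 1) {e : ℕ → ℝ}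
    (hΩ : ∀ i ∈ Icc 1 K, ∀ p : Fin (L i) → Fin n × Fin 4,
      (#(Ω ∩ levelSet κ i p) : ℝ) ≤ 2 / 5 * #(levelSet κ i p) + e i)
    {x : Fin n → ℂ} (hx : ∀ t ∉ T, x t = 0) (hx1 : ∑ t, ‖x t‖ ^ 2 = 1) :
    n * ∑ j ∈ Ω, ‖(dftMatrix n).mulVec x j‖ ^ 2 ≤
      1 / 20 * #Ω + 4 / 9 * n + 1 / 20 * ∑ i ∈ Icc 1 K, e i := by
  have hn' : (0 : ℝ) < n := by exact_mod_cast hn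
  set U : Matrix (Fin n) (Fin n) ℂ := (Real.sqrt n : ℂ) • dftMatrix n with hUdef
  set R : ℝ := Real.sqrt (2 * κ) with hR
  have hR0 : 0 < R := Real.sqrt_pos.2 (by positivity)
  have hR2 : R ^ 2 = 2 * κ := Real.sq_sqrt (by positivity)
  have hU (j t) : ‖U j t‖ ≤ 1 := by
    have : Real.sqrt n ≠ 0 := (Real.sqrt_pos.2 hn').ne'
    rw [hUdef, Matrix.smul_apply, norm_smul, norm_dftMatrix_apply, Complex.norm_real,
      Real.norm_of_nonneg (Real.sqrt_nonneg _), mul_one_div_cancel this]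
  have hxR : ∑ t, (|(x t).re| + |(x t).im|) ≤ R := sum_abs_re_add_abs_im_le hT hx hx1
  have hv (j : Fin n) : ‖U.mulVec x j‖ ^ 2 = n * ‖(dftMatrix n).mulVec x j‖ ^ 2 := by
    rw [hUdef, Matrix.smul_mulVec, Pi.smul_apply, norm_smul, Complex.norm_real, mul_pow,
      Real.norm_of_nonneg (Real.sqrt_nonneg _), Real.sq_sqrt hn'.le]
  have hvsum : ∑ j, ‖U.mulVec x j‖ ^ 2 = n := by
    simp_rw [hv]
    rw [← mul_sum, sum_norm_sq_dftMatrix_mulVec, hx1, mul_one]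
  have hvK (j : Fin n) : ‖U.mulVec x j‖ ^ 2 ≤ 1 / 20 * K := by
    have : ‖U.mulVec x j‖ ≤ R := by
      rw [Matrix.mulVec, dotProduct]
      refine le_trans (norm_sum_le_of_le _ fun t _ => ?_) hxR
      rw [norm_mul]
      exact (mul_le_of_le_one_left (norm_nonneg _) (hU j t)).trans
        (Complex.norm_le_abs_re_add_abs_im _)
    have := pow_le_pow_left₀ (norm_nonneg _) this 2
    linarith
  have key := sum_le_of_card_superlevel_le (v := fun j => ‖U.mulVec x j‖ ^ 2)
    (fun j => by positivity) Ω (h := 1 / 20) (β := 9 / 10) (γ := 2 / 5) (by norm_num)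
    (by norm_num) (by norm_num) hvK e (by
      intro i hi
      have hsq : 0 ≤ Real.sqrt (1 / 20 * i) := Real.sqrt_nonneg _
      have hsq2 : Real.sqrt (1 / 20 * i) ^ 2 = 1 / 20 * i := Real.sq_sqrt (by positivity)
      set τ := Real.sqrt (1 / 20 * i) with hτ
      obtain ⟨p, hp⟩ := exists_columnMean_approx hn hU hR0 hxR (hL i) (τ := τ / 40)
        (by positivity) (by
          refine lt_of_eq_of_lt ?_ (hexp i hi)
          congr 3
          rw [div_pow, hsq2, hR2]
          field_simp
          ring)
      have h1 : (#{j ∈ Ω | 1 / 20 * (i : ℝ) ≤ ‖U.mulVec x j‖ ^ 2} : ℝ) ≤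
          #(Ω ∩ levelSet κ i p) := by
        norm_cast
        apply card_le_card
        intro j hj
        rw [mem_filter] at hj
        rw [mem_inter, levelSet, mem_filter]
        refine ⟨hj.1, mem_univ _, ?_⟩
        have ha : τ ≤ ‖U.mulVec x j‖ := by
          rw [hτ]
          exact Real.sqrt_le_iff.2 ⟨norm_nonneg _, hj.2⟩
        have hb := norm_sub_norm_le (U.mulVec x j) (columnMean U R p j)
        rw [norm_sub_rev] at hb
        have := hp j
        linarith
      have h2 : (#(levelSet κ i p) : ℝ) ≤
          #{j | 9 / 10 * (1 / 20 * (i : ℝ)) ≤ ‖U.mulVec x j‖ ^ 2} := by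
        norm_cast
        apply card_le_card
        intro j hj
        rw [levelSet, mem_filter] at hj
        rw [mem_filter]
        refine ⟨mem_univ _, ?_⟩
        have hb := norm_sub_norm_le (columnMean U R p j) (U.mulVec x j)
        have ha : 38 / 40 * τ ≤ ‖U.mulVec x j‖ := by linarith [hp j, hj.2]
        have := pow_le_pow_left₀ (by positivity) ha 2
        rw [mul_pow, hsq2] at this
        have : (0 : ℝ) ≤ i := by positivity
        linarith
      linarith [hΩ i hi p])
  rw [hvsum] at key
  simp_rw [hv] at key
  rw [← mul_sum] at key
  linarith

theorem uniformSetProb_exists_levelSet_le {n m : ℕ} (h : 3 * m ≤ n) (κ : ℝ) (K : ℕ) (L : ℕ → ℕ)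
    (e : ℕ → ℝ) :
    uniformSetProb n m (fun Ω => ∃ i ∈ Icc 1 K, ∃ p ∈ (univ : Finset (Fin (L i) → Fin n × Fin 4)),
      2 / 5 * (#(levelSet κ i p) : ℝ) + e i < #(Ω ∩ levelSet κ i p)) ≤
      ∑ i ∈ Icc 1 K, (4 * n : ℝ) ^ L i * Real.exp (-(e i / 6)) := by
  refine (uniformSetProb_exists_le _ _).trans (sum_le_sum fun i _ => ?_)
  refine (uniformSetProb_exists_le _ _).trans ?_
  refine (sum_le_sum fun p _ => uniformSetProb_lt_card_inter_le h _ _).trans_eq ?_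
  rw [sum_const, nsmul_eq_mul, card_univ, Fintype.card_fun, Fintype.card_prod, Fintype.card_fin,
    Fintype.card_fin, Fintype.card_fin, mul_comm n 4]
  push_cast
  rfl

theorem sum_Icc_div_le {K : ℕ} {l : ℝ} (hl : 1 ≤ l) (hK : Real.log K ≤ l) {a : ℝ} (ha : 0 ≤ a) :
    ∑ i ∈ Icc 1 K, a / (i : ℝ) ≤ a * (2 * l) := by
  have h := harmonic_le_one_add_log K
  rw [harmonic_eq_sum_Icc] at h
  push_cast at h
  simp_rw [div_eq_mul_inv]
  rw [← mul_sum]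
  exact mul_le_mul_of_nonneg_left (by linarith) ha

theorem pow_five_le_exp {l : ℝ} (hl : 720 ≤ l) : l ^ 5 ≤ Real.exp l := by
  have h := Real.pow_div_factorial_le_exp (x := l) (by linarith) 6
  have : l ^ 5 * 720 ≤ l ^ 6 := by
    rw [pow_succ l 5]
    gcongr
  norm_num [Nat.factorial] at h
  linarith

theorem four_mul_pow_mul_exp_le {n L i : ℕ} {l κ : ℝ} (hl : 20000 ≤ l)
    (hn : Real.exp l = n) (hκ : κ = n / l ^ 5) (hi : 1 ≤ i) (hiκ : (i : ℝ) ≤ 41 * κ)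
    (hL : (L : ℝ) ≤ 2048000 * κ * Real.log (4 * n) / i + 1) :
    (4 * n : ℝ) ^ L * Real.exp (-(3 * n / (10 * l) / i / 6)) ≤
      Real.exp (-(3 * n / (10 * l) / i / 12)) := by
  have hn0 : (0 : ℝ) < n := by rw [← hn]; exact Real.exp_pos l
  have hi0 : (0 : ℝ) < i := by exact_mod_cast hi
  have hκ0 : 0 < κ := by rw [hκ]; positivity
  have hlog0 : Real.log (4 * n) = Real.log 4 + l := by
    rw [Real.log_mul (by norm_num) hn0.ne', ← hn, Real.log_exp]
  have hlog : Real.log (4 * n) ≤ 2 * l := by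
    have := Real.log_le_sub_one_of_pos (show (0 : ℝ) < 4 by norm_num)
    linarith
  have hlogpos : 0 ≤ Real.log (4 * n) := by
    have := Real.log_nonneg (show (1 : ℝ) ≤ 4 by norm_num)
    linarith
  have h1 : (1 : ℝ) ≤ 41 * κ / i := by rwa [le_div_iff₀ hi0, one_mul]
  have hLl : (L : ℝ) * Real.log (4 * n) ≤ 3 * n / (10 * l) / i / 12 := by
    calc (L : ℝ) * Real.log (4 * n) ≤ (2048000 * κ * (2 * l) / i + 41 * κ / i) * (2 * l) := by
          gcongr
          refine hL.trans (add_le_add ?_ h1)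
          gcongr
      _ ≤ (10000000 * l ^ 2) * (κ / i) := by
          have : 0 ≤ κ / i := by positivity
          calc _ = (8192000 * l ^ 2 + 82 * l) * (κ / i) := by ring
            _ ≤ _ := by gcongr; nlinarith
      _ = 10000000 * n / (l ^ 3 * i) := by
          rw [hκ]; field_simp
      _ ≤ 3 * n / (10 * l) / i / 12 := by
          have h2 : (400000000 : ℝ) ≤ l ^ 2 := by nlinarith
          calc _ = 10000000 / l ^ 2 * (n / (l * i)) := by field_simp
            _ ≤ 1 / 40 * (n / (l * i)) := by
                refine mul_le_mul_of_nonneg_right ?_ (by positivity)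
                rw [div_le_div_iff₀ (by positivity) (by norm_num)]
                linarith
            _ = _ := by field_simp; norm_num
  have h4n : (4 * n : ℝ) = Real.exp (Real.log (4 * n)) := (Real.exp_log (by positivity)).symm
  rw [h4n, ← Real.exp_nat_mul, ← Real.exp_add]
  apply Real.exp_le_exp.2
  linarith

theorem sum_exp_neg_le_rpow {n K : ℕ} {l κ s : ℝ} (hl : 20000 ≤ l) (hs : s + 1 ≤ l)
    (hn : Real.exp l = n) (hκ : κ = n / l ^ 5) (hKn : (K : ℝ) ≤ n) (hKκ : (K : ℝ) ≤ 41 * κ) :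
    ∑ i ∈ Icc 1 K, Real.exp (-(3 * n / (10 * l) / i / 12)) ≤ (n : ℝ) ^ (-s) := by
  have hn0 : (0 : ℝ) < n := by rw [← hn]; exact Real.exp_pos l
  have hterm : ∀ i ∈ Icc 1 K,
      Real.exp (-(3 * n / (10 * l) / i / 12)) ≤ Real.exp (-(l ^ 4 / 1640)) := by
    intro i hi
    rw [mem_Icc] at hi
    have hi0 : (0 : ℝ) < i := by exact_mod_cast hi.1
    have hiκ : (i : ℝ) ≤ 41 * κ := le_trans (by exact_mod_cast hi.2) hKκ
    apply Real.exp_le_exp.2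
    rw [neg_le_neg_iff]
    have e1 : l ^ 4 / 1640 = 3 * n / (10 * l) / (41 * κ) / 12 := by
      rw [hκ]; field_simp; norm_num
    rw [e1]
    gcongr
  calc _ ≤ ∑ i ∈ Icc 1 K, Real.exp (-(l ^ 4 / 1640)) := sum_le_sum hterm
    _ = K * Real.exp (-(l ^ 4 / 1640)) := by simp
    _ ≤ Real.exp l * Real.exp (-(l ^ 4 / 1640)) := by rw [hn]; gcongr
    _ ≤ (n : ℝ) ^ (-s) := by
        rw [← hn, ← Real.exp_mul, ← Real.exp_add]
        apply Real.exp_le_exp.2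
        have h3 : (1640 : ℝ) * l ≤ l ^ 3 := by
          have : (1640 : ℝ) ≤ l ^ 2 := by nlinarith
          nlinarith
        have h4 : l * (s + 1) ≤ l * (l ^ 3 / 1640) := by
          gcongr
          linarith
        linarith

end Lemmas

open Finset in
/-- There are an absolute constant `c > 0` and, for each `s ≥ 1`, a threshold `N(s)` such that
for `n ≥ N(s)`: except with probability at most `n^{−s}`, a uniformly random subset `Ω` of
`{1,…,n}` of fixed cardinality `|Ω| ≤ n/3` has the property that for every set `T` with
`|T| ≤ c n / (s log⁵ n)` one has `‖F_{ΩT}‖² ≤ 0.5`. -/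
theorem stmt_10 :
    ∃ c : ℝ, 0 < c ∧
      ∀ s : ℝ, 1 ≤ s → ∃ N : ℕ, ∀ n : ℕ, N ≤ n → ∀ mΩ : ℕ, (mΩ : ℝ) ≤ n / 3 →
        uniformSetProb n mΩ (fun Ω =>
            ¬ ∀ T : Finset (Fin n), (T.card : ℝ) ≤ c * n / (s * Real.log n ^ 5) →
                specNorm (dftSub n Ω T) ^ 2 ≤ 0.5) ≤
          (n : ℝ) ^ (-s) := by
  refine ⟨1, one_pos, fun s hs => ⟨⌈Real.exp (max 20000 (s + 1))⌉₊, fun n hn mΩ hm => ?_⟩⟩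
  have hn1 : Real.exp (max 20000 (s + 1)) ≤ n := (Nat.le_ceil _).trans (by exact_mod_cast hn)
  have hn0 : (0 : ℝ) < n := (Real.exp_pos _).trans_le hn1
  have hnpos : 0 < n := by exact_mod_cast hn0
  obtain ⟨l, hldef⟩ : ∃ l, l = Real.log n := ⟨_, rfl⟩
  have hexpl : Real.exp l = n := by rw [hldef, Real.exp_log hn0]
  have hmax : max 20000 (s + 1) ≤ l := by rw [hldef]; exact (Real.le_log_iff_exp_le hn0).2 hn1
  have hl : 20000 ≤ l := (le_max_left _ _).trans hmax
  have hsl : s + 1 ≤ l := (le_max_right _ _).trans hmax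
  obtain ⟨κ, hκ⟩ : ∃ κ : ℝ, κ = n / l ^ 5 := ⟨_, rfl⟩
  have hl5 : l ^ 5 ≤ n := hexpl ▸ pow_five_le_exp (by linarith)
  have hl0 : 0 < l := by linarith
  have hκ1 : 1 ≤ κ := by rw [hκ, one_le_div (by positivity)]; exact hl5
  have hκ0 : 0 < κ := by linarith
  obtain ⟨K, hKdef⟩ : ∃ K, K = ⌈40 * κ⌉₊ := ⟨_, rfl⟩
  have hK : 40 * κ ≤ K := hKdef ▸ Nat.le_ceil _
  have hKκ : (K : ℝ) ≤ 41 * κ := by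
    have := Nat.ceil_lt_add_one (show 0 ≤ 40 * κ by positivity)
    rw [hKdef]; linarith
  have hKn : (K : ℝ) ≤ n := by
    have : 41 ≤ l ^ 5 := le_trans (by linarith) (le_self_pow₀ (by linarith : 1 ≤ l) (by norm_num))
    calc (K : ℝ) ≤ 41 * κ := hKκ
      _ ≤ l ^ 5 * κ := by gcongr
      _ = n := by rw [hκ]; field_simp
  have hlogK : Real.log K ≤ l := by
    rw [hldef]
    exact Real.log_le_log (by linarith) hKn
  have h3m : 3 * mΩ ≤ n := by
    have : (3 : ℝ) * mΩ ≤ n := by linarith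
    exact_mod_cast this
  set L : ℕ → ℕ := fun i => ⌊2048000 * κ * Real.log (4 * n) / i⌋₊ + 1 with hL
  set e : ℕ → ℝ := fun i => 3 * n / (10 * l) / i with he
  have hlog4 : 0 ≤ Real.log (4 * n) := Real.log_nonneg (by
    have : (1 : ℝ) ≤ n := by exact_mod_cast hnpos
    linarith)
  refine le_trans (uniformSetProb_mono (q := fun Ω => ∃ i ∈ Icc 1 K,
    ∃ p ∈ (univ : Finset (Fin (L i) → Fin n × Fin 4)),
      2 / 5 * (#(levelSet κ i p) : ℝ) + e i < #(Ω ∩ levelSet κ i p)) ?_) ?_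
  · intro Ω hΩ hbad
    by_contra! hgood
    refine hbad fun T hT => ?_
    have hTκ : (#T : ℝ) ≤ κ := by
      refine hT.trans ?_
      rw [one_mul, hκ, ← hldef]
      gcongr
      exact le_mul_of_one_le_left (by positivity) hs
    refine specNorm_dftSub_sq_le (by norm_num) fun x hx hx1 => ?_
    have hmain := sum_norm_sq_dftMatrix_mulVec_le hnpos hκ0 hTκ hK (L := L)
      (fun i => Nat.succ_pos _) (by
        intro i hi
        have hi0 : (0 : ℝ) < i := by exact_mod_cast (mem_Icc.1 hi).1
        have hlt := Nat.lt_floor_add_one (2048000 * κ * Real.log (4 * n) / i)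
        rw [div_lt_iff₀ hi0] at hlt
        have h4n : (4 * n : ℝ) = Real.exp (Real.log (4 * n)) := (Real.exp_log (by positivity)).symm
        rw [h4n, ← Real.exp_add]
        rw [← Real.exp_zero]
        apply Real.exp_lt_exp.2
        rw [← sub_eq_add_neg, sub_neg, lt_div_iff₀ (by positivity), hL]
        push_cast
        linarith)
      (e := e) (fun i hi p => hgood i hi p (mem_univ p)) hx hx1
    have hesum : ∑ i ∈ Icc 1 K, e i ≤ 3 * n / (10 * l) * (2 * l) :=
      sum_Icc_div_le (by linarith) hlogK (by positivity)
    have he2 : 3 * n / (10 * l) * (2 * l) = 3 / 5 * n := by field_simp; norm_num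
    rw [hΩ] at hmain
    refine le_of_mul_le_mul_left ?_ hn0
    linarith
  · refine (uniformSetProb_exists_levelSet_le h3m κ K L e).trans
      (le_trans (sum_le_sum fun i hi => ?_) (sum_exp_neg_le_rpow hl hsl hexpl hκ hKn hKκ))
    rw [mem_Icc] at hi
    have hiκ : (i : ℝ) ≤ 41 * κ := le_trans (by exact_mod_cast hi.2) hKκ
    refine four_mul_pow_mul_exp_le hl hexpl hκ hi.1 hiκ ?_
    rw [hL]
    push_cast
    gcongr
    exact Nat.floor_le (by positivity)
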